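/- Let s = (x,y) ∈ ℝ² with s ≠ 0 and let π ∈ ℝ². Then the first component of the vector (J_w̄(s) S(s))⁻¹ π = S(s)ᵀ J_w̄(s)⁻¹ π equals (sᵀ π) / ((1 + x² + y²) ‖s‖). In particular, the first component of (J_w̄ S)⁻¹ π is nonpositive if and only if sᵀ π ≤ 0. -/

import Mathlib

open Matrix

/-- The point `s = (x,y)` as a vector of `ℝ²` with the Euclidean norm. -/
noncomputable def e2 (a b : ℝ) : EuclideanSpace ℝ (Fin 2) :=
  (WithLp.equiv 2 (Fin 2 → ℝ)).symm ![a, b]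

/-- The matrix `J_w̄(x,y) = [[xy, −(1+x²)],[1+y², −xy]]`. -/
def Jwbar (x y : ℝ) : Matrix (Fin 2) (Fin 2) ℝ :=
  !![x * y, -(1 + x ^ 2); 1 + y ^ 2, -(x * y)]

/-- The matrix `S(s)` whose columns are `−s_⊥/‖s_⊥‖` and `s/‖s‖`, where
`s = (x,y)` and `s_⊥ = (−y, x)`. -/
noncomputable def Smat (x y : ℝ) : Matrix (Fin 2) (Fin 2) ℝ :=
  !![y / ‖e2 (-y) x‖, x / ‖e2 x y‖; -x / ‖e2 (-y) x‖, y / ‖e2 x y‖]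

theorem norm_e2_sq (a b : ℝ) : ‖e2 a b‖ ^ 2 = a ^ 2 + b ^ 2 := by
  simp [EuclideanSpace.norm_sq_eq, e2, Fin.sum_univ_two]

theorem norm_e2_neg_swap (x y : ℝ) : ‖e2 (-y) x‖ = ‖e2 x y‖ := by
  rw [← sq_eq_sq₀ (norm_nonneg _) (norm_nonneg _), norm_e2_sq, norm_e2_sq]
  ring

theorem norm_e2_pos {x y : ℝ} (hs : ¬(x = 0 ∧ y = 0)) : 0 < ‖e2 x y‖ := by
  refine (norm_nonneg _).lt_of_ne' fun h => hs ?_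
  have hsq := norm_e2_sq x y
  rw [h] at hsq
  constructor <;> nlinarith [sq_nonneg x, sq_nonneg y]

theorem Smat_transpose_mul_self {x y : ℝ} (hs : ¬(x = 0 ∧ y = 0)) :
    (Smat x y)ᵀ * Smat x y = 1 := by
  have hr := (norm_e2_pos hs).ne'
  have hsq := norm_e2_sq x y
  ext i j
  fin_cases i <;> fin_cases j <;>
    simp [Smat, norm_e2_neg_swap, Matrix.mul_apply, Fin.sum_univ_two] <;>
    field_simp <;> linarith

theorem Jwbar_inv (x y : ℝ) :
    (Jwbar x y)⁻¹ =
      (1 + x ^ 2 + y ^ 2)⁻¹ • !![-(x * y), 1 + x ^ 2; -(1 + y ^ 2), x * y] := by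
  have hdet : (Jwbar x y).det = 1 + x ^ 2 + y ^ 2 := by
    rw [Jwbar, Matrix.det_fin_two_of]
    ring
  rw [Matrix.inv_def, hdet, Ring.inverse_eq_inv', Jwbar, Matrix.adjugate_fin_two_of, neg_neg]

/-- For `s = (x,y) ≠ 0`: `(J_w̄ S)⁻¹ π = Sᵀ J_w̄⁻¹ π`, the first component of
`(J_w̄ S)⁻¹ π` equals `sᵀπ / ((1+x²+y²)‖s‖)`, and it is nonpositive iff
`sᵀπ ≤ 0`. -/
theorem first_component_of_inverse (x y : ℝ) (p : Fin 2 → ℝ)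
    (hs : ¬(x = 0 ∧ y = 0)) :
    (Jwbar x y * Smat x y)⁻¹.mulVec p =
      (Smat x y)ᵀ.mulVec ((Jwbar x y)⁻¹.mulVec p) ∧
    ((Jwbar x y * Smat x y)⁻¹.mulVec p) 0 =
      (x * p 0 + y * p 1) / ((1 + x ^ 2 + y ^ 2) * ‖e2 x y‖) ∧
    (((Jwbar x y * Smat x y)⁻¹.mulVec p) 0 ≤ 0 ↔ x * p 0 + y * p 1 ≤ 0) := by
  have hr := norm_e2_pos hs
  have hd : 0 < 1 + x ^ 2 + y ^ 2 := by positivity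
  have hinv : (Jwbar x y * Smat x y)⁻¹.mulVec p =
      (Smat x y)ᵀ.mulVec ((Jwbar x y)⁻¹.mulVec p) := by
    rw [Matrix.mul_inv_rev, Matrix.inv_eq_left_inv (Smat_transpose_mul_self hs),
      Matrix.mulVec_mulVec]
  have hfirst : ((Jwbar x y * Smat x y)⁻¹.mulVec p) 0 =
      (x * p 0 + y * p 1) / ((1 + x ^ 2 + y ^ 2) * ‖e2 x y‖) := by
    rw [hinv, Jwbar_inv]
    simp [Smat, norm_e2_neg_swap, Matrix.mulVec, dotProduct, Fin.sum_univ_two]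
    field_simp
    ring
  refine ⟨hinv, hfirst, ?_⟩
  rw [hfirst, div_le_iff₀ (mul_pos hd hr), zero_mul]
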